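/- arXiv:2211.05861 — 3 statements merged into one kernel-verified Lean document; each statement's English description precedes it below -/
import Mathlib

section
/- Let (C₁, W₁) and (C₂, W₂) be relative categories and let (L, R, η, ε) be a Dwyer–Kan adjunction of relative categories, with L : C₁ ⥤ C₂ and R : C₂ ⥤ C₁. Then the induced functor L̄ : C₁[W₁⁻¹] ⥤ C₂[W₂⁻¹] on localizations is an equivalence of categories. -/
open CategoryTheory

/-- Let `(C₁, W₁)` and `(C₂, W₂)` be relative categories with localization functors
`Q₁ : C₁ ⥤ D₁` and `Q₂ : C₂ ⥤ D₂`, and let `(L, R, η, ε)` be a Dwyer–Kan adjunction of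
relative categories: `L(W₁) ⊆ W₂`, `R(W₂) ⊆ W₁`, all unit components lie in `W₁` and all
counit components lie in `W₂`. Then the induced functor `L' : D₁ ⥤ D₂` on localizations
(characterized by `Q₁ ⋙ L' ≅ L ⋙ Q₂`) is an equivalence of categories. -/
theorem localized_left_adjoint_isEquivalence
    {C₁ C₂ D₁ D₂ : Type*} [Category C₁] [Category C₂] [Category D₁] [Category D₂]
    (W₁ : MorphismProperty C₁) (W₂ : MorphismProperty C₂)
    (Q₁ : C₁ ⥤ D₁) (Q₂ : C₂ ⥤ D₂) [Q₁.IsLocalization W₁] [Q₂.IsLocalization W₂]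
    (L : C₁ ⥤ C₂) (R : C₂ ⥤ C₁) (adj : L ⊣ R)
    (hL : ∀ ⦃X Y : C₁⦄ (f : X ⟶ Y), W₁ f → W₂ (L.map f))
    (hR : ∀ ⦃X Y : C₂⦄ (f : X ⟶ Y), W₂ f → W₁ (R.map f))
    (hunit : ∀ X : C₁, W₁ (adj.unit.app X))
    (hcounit : ∀ Y : C₂, W₂ (adj.counit.app Y))
    (L' : D₁ ⥤ D₂) (eL : Q₁ ⋙ L' ≅ L ⋙ Q₂) :
    L'.IsEquivalence := by
  have hRQ : W₂.IsInvertedBy (R ⋙ Q₁) := fun _ _ f hf ↦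
    Localization.inverts Q₁ W₁ _ (hR f hf)
  let R' : D₂ ⥤ D₁ := Localization.lift (R ⋙ Q₁) hRQ Q₂
  let eR : Q₂ ⋙ R' ≅ R ⋙ Q₁ := Localization.fac (R ⋙ Q₁) hRQ Q₂
  have (X : C₁) : IsIso ((Functor.whiskerRight adj.unit Q₁).app X) :=
    Localization.inverts Q₁ W₁ _ (hunit X)
  have (Y : C₂) : IsIso ((Functor.whiskerRight adj.counit Q₂).app Y) :=
    Localization.inverts Q₂ W₂ _ (hcounit Y)
  have : IsIso (Functor.whiskerRight adj.unit Q₁) := NatIso.isIso_of_isIso_app _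
  have : IsIso (Functor.whiskerRight adj.counit Q₂) := NatIso.isIso_of_isIso_app _
  let : Localization.Lifting Q₁ W₁ (L ⋙ Q₂) L' := ⟨eL⟩
  let α : (L ⋙ Q₂) ⋙ R' ≅ Q₁ :=
    Functor.isoWhiskerLeft L eR ≪≫ (asIso (Functor.whiskerRight adj.unit Q₁)).symm
  let β : (R ⋙ Q₁) ⋙ L' ≅ Q₂ :=
    Functor.isoWhiskerLeft R eL ≪≫ asIso (Functor.whiskerRight adj.counit Q₂)
  exact Localization.isEquivalence Q₁ W₁ Q₂ W₂ (L ⋙ Q₂) L' (R ⋙ Q₁) R' α β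
end

section
/- Let (C₁, W₁) and (C₂, W₂) be relative categories and let (L, R, η, ε) be a Dwyer–Kan adjunction of relative categories, with L : C₁ ⥤ C₂ and R : C₂ ⥤ C₁. Then the induced functor R̄ : C₂[W₂⁻¹] ⥤ C₁[W₁⁻¹] on localizations is an equivalence of categories. -/
open CategoryTheory

/-- Let `(C₁, W₁)` and `(C₂, W₂)` be relative categories with localization functors
`Q₁ : C₁ ⥤ D₁` and `Q₂ : C₂ ⥤ D₂`, and let `(L, R, η, ε)` be a Dwyer–Kan adjunction of
relative categories: `L(W₁) ⊆ W₂`, `R(W₂) ⊆ W₁`, all unit components lie in `W₁` and all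
counit components lie in `W₂`. Then the induced functor `R' : D₂ ⥤ D₁` on localizations
(characterized by `Q₂ ⋙ R' ≅ R ⋙ Q₁`) is an equivalence of categories. -/
theorem localized_right_adjoint_isEquivalence
    {C₁ C₂ D₁ D₂ : Type*} [Category C₁] [Category C₂] [Category D₁] [Category D₂]
    (W₁ : MorphismProperty C₁) (W₂ : MorphismProperty C₂)
    (Q₁ : C₁ ⥤ D₁) (Q₂ : C₂ ⥤ D₂) [Q₁.IsLocalization W₁] [Q₂.IsLocalization W₂]
    (L : C₁ ⥤ C₂) (R : C₂ ⥤ C₁) (adj : L ⊣ R)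
    (hL : ∀ ⦃X Y : C₁⦄ (f : X ⟶ Y), W₁ f → W₂ (L.map f))
    (hR : ∀ ⦃X Y : C₂⦄ (f : X ⟶ Y), W₂ f → W₁ (R.map f))
    (hunit : ∀ X : C₁, W₁ (adj.unit.app X))
    (hcounit : ∀ Y : C₂, W₂ (adj.counit.app Y))
    (R' : D₂ ⥤ D₁) (eR : Q₂ ⋙ R' ≅ R ⋙ Q₁) :
    R'.IsEquivalence := by
  have hinv : W₁.IsInvertedBy (L ⋙ Q₂) := fun _ _ f hf =>
    Localization.inverts Q₂ W₂ (L.map f) (hL f hf)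
  have : ∀ X, IsIso ((Functor.whiskerRight adj.unit Q₁).app X) := fun X =>
    Localization.inverts Q₁ W₁ _ (hunit X)
  have : ∀ Y, IsIso ((Functor.whiskerRight adj.counit Q₂).app Y) := fun Y =>
    Localization.inverts Q₂ W₂ _ (hcounit Y)
  have : IsIso (Functor.whiskerRight adj.unit Q₁) := NatIso.isIso_of_isIso_app _
  have : IsIso (Functor.whiskerRight adj.counit Q₂) := NatIso.isIso_of_isIso_app _
  let : Localization.Lifting Q₂ W₂ (R ⋙ Q₁) R' := ⟨eR⟩
  exact Localization.isEquivalence Q₂ W₂ Q₁ W₁ (R ⋙ Q₁) R' (L ⋙ Q₂)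
    (Localization.lift (L ⋙ Q₂) hinv Q₁)
    (Functor.associator _ _ _ ≪≫
      Functor.isoWhiskerLeft R (Localization.fac (L ⋙ Q₂) hinv Q₁) ≪≫
      (Functor.associator _ _ _).symm ≪≫
      asIso (Functor.whiskerRight adj.counit Q₂) ≪≫ Functor.leftUnitor _)
    (Functor.associator _ _ _ ≪≫ Functor.isoWhiskerLeft L eR ≪≫
      (Functor.associator _ _ _).symm ≪≫
      (asIso (Functor.whiskerRight adj.unit Q₁)).symm ≪≫ Functor.leftUnitor _)
end

section
/- Let (C₁, W₁) and (C₂, W₂) be relative categories and let (L, R, η, ε) be a Dwyer–Kan adjunction of relative categories, with L : C₁ ⥤ C₂ and R : C₂ ⥤ C₁. Then the induced functors L̄ : C₁[W₁⁻¹] ⥤ C₂[W₂⁻¹] and R̄ : C₂[W₂⁻¹] ⥤ C₁[W₁⁻¹] are mutually quasi-inverse: there are natural isomorphisms R̄ ⋙ L̄ ≅ id and L̄ ⋙ R̄ ≅ id (i.e., L̄ and R̄ fit into an adjoint equivalence with unit and counit induced from η and ε). -/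
open CategoryTheory

/-- A natural transformation out of a localized category is invertible as soon as its components
at the objects in the image of the localization functor are. -/
lemma isIso_natTrans_of_isIso_app_localization {C D E : Type*} [Category C] [Category D]
    [Category E] (Q : C ⥤ D) (W : MorphismProperty C) [Q.IsLocalization W] {F G : D ⥤ E}
    (τ : F ⟶ G) (h : ∀ X : C, IsIso (τ.app (Q.obj X))) : IsIso τ := by
  have := Localization.essSurj Q W
  have (Y : D) : IsIso (τ.app Y) :=
    (NatTrans.isIso_app_iff_of_iso τ (Q.objObjPreimageIso Y)).1 (h _)
  exact NatIso.isIso_of_isIso_app τ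

/-- Let `(C₁, W₁)` and `(C₂, W₂)` be relative categories with localization functors
`Q₁ : C₁ ⥤ D₁` and `Q₂ : C₂ ⥤ D₂`, and let `(L, R, η, ε)` be a Dwyer–Kan adjunction of
relative categories: `L(W₁) ⊆ W₂`, `R(W₂) ⊆ W₁`, all unit components lie in `W₁` and all
counit components lie in `W₂`. Then the induced functors `L' : D₁ ⥤ D₂` and `R' : D₂ ⥤ D₁`
on localizations are mutually quasi-inverse: `R' ⋙ L' ≅ 𝟭` and `L' ⋙ R' ≅ 𝟭`, and they fit
into an adjoint equivalence (an adjunction `L' ⊣ R'` with invertible unit and counit). -/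
theorem localized_functors_mutually_quasi_inverse
    {C₁ C₂ D₁ D₂ : Type*} [Category C₁] [Category C₂] [Category D₁] [Category D₂]
    (W₁ : MorphismProperty C₁) (W₂ : MorphismProperty C₂)
    (Q₁ : C₁ ⥤ D₁) (Q₂ : C₂ ⥤ D₂) [Q₁.IsLocalization W₁] [Q₂.IsLocalization W₂]
    (L : C₁ ⥤ C₂) (R : C₂ ⥤ C₁) (adj : L ⊣ R)
    (hL : ∀ ⦃X Y : C₁⦄ (f : X ⟶ Y), W₁ f → W₂ (L.map f))
    (hR : ∀ ⦃X Y : C₂⦄ (f : X ⟶ Y), W₂ f → W₁ (R.map f))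
    (hunit : ∀ X : C₁, W₁ (adj.unit.app X))
    (hcounit : ∀ Y : C₂, W₂ (adj.counit.app Y))
    (L' : D₁ ⥤ D₂) (R' : D₂ ⥤ D₁)
    (eL : Q₁ ⋙ L' ≅ L ⋙ Q₂) (eR : Q₂ ⋙ R' ≅ R ⋙ Q₁) :
    Nonempty (R' ⋙ L' ≅ 𝟭 D₂) ∧ Nonempty (L' ⋙ R' ≅ 𝟭 D₁) ∧
      ∃ adj' : L' ⊣ R', IsIso adj'.unit ∧ IsIso adj'.counit := by
  let : CatCommSq L Q₁ Q₂ L' := ⟨eL.symm⟩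
  let : CatCommSq R Q₂ Q₁ R' := ⟨eR.symm⟩
  let adj' : L' ⊣ R' := adj.localization Q₁ W₁ Q₂ W₂ L' R'
  have isIso_unit : IsIso adj'.unit :=
    isIso_natTrans_of_isIso_app_localization Q₁ W₁ _ fun X ↦ by
      have := Localization.inverts Q₁ W₁ _ (hunit X)
      rw [adj.localization_unit_app Q₁ W₁ Q₂ W₂ L' R' X]
      infer_instance
  have isIso_counit : IsIso adj'.counit :=
    isIso_natTrans_of_isIso_app_localization Q₂ W₂ _ fun Y ↦ by
      have := Localization.inverts Q₂ W₂ _ (hcounit Y)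
      rw [adj.localization_counit_app Q₁ W₁ Q₂ W₂ L' R' Y]
      infer_instance
  exact ⟨⟨asIso adj'.counit⟩, ⟨(asIso adj'.unit).symm⟩, adj', isIso_unit, isIso_counit⟩
end
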